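/- Let φ : Ω → ℝ be Lipschitz on a bounded open set Ω ⊆ ℝⁿ with |∇φ| ≥ C_min > 0 a.e. near φ⁻¹(0), and suppose ρ ↦ H^{n−1}(φ⁻¹(ρ)) is bounded by a constant M on a neighborhood of 0. Then the Lebesgue measure of the set φ⁻¹((−ε, 0]) is at most (M/C_min)·ε for all sufficiently small ε > 0. -/

import Mathlib

open MeasureTheory

/-- straightening map -/
noncomputable def straighten {m : ℕ} (e : EuclideanSpace ℝ (Fin (m + 1)))
    (ψ : EuclideanSpace ℝ (Fin (m + 1)) → ℝ) (y : EuclideanSpace ℝ (Fin (m + 1))) :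
    EuclideanSpace ℝ (Fin (m + 1)) :=
  y + (ψ y - inner ℝ e y) • e

lemma slice_lemma {m : ℕ} (e : EuclideanSpace ℝ (Fin (m + 1))) (he : ‖e‖ = 1)
    (ψ : EuclideanSpace ℝ (Fin (m + 1)) → ℝ) (hψ : Continuous ψ)
    (s : Set (EuclideanSpace ℝ (Fin (m + 1)))) (hs : MeasurableSet s)
    (hinj : Set.InjOn (straighten e ψ) s) :
    ∃ g : ℝ → ENNReal, Measurable g ∧ volume (straighten e ψ '' s) = ∫⁻ t, g t ∧
      ∀ t, g t ≤ (μH[(m : ℝ)] : Measure (EuclideanSpace ℝ (Fin (m + 1)))) (s ∩ ψ ⁻¹' {t}) := by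
  obtain ⟨b, hb⟩ : ∃ b : OrthonormalBasis (Fin (m + 1)) ℝ (EuclideanSpace ℝ (Fin (m + 1))),
      b 0 = e := by
    obtain ⟨b, hb⟩ := Orthonormal.exists_orthonormalBasis_extension_of_card_eq
      (𝕜 := ℝ) (E := EuclideanSpace ℝ (Fin (m + 1))) (ι := Fin (m + 1)) (by simp)
      (v := fun _ => e) (s := {0}) (by
        refine ⟨fun i => by simpa using he, fun i j hij => ?_⟩
        exact absurd (Subsingleton.elim i j) hij)
    exact ⟨b, hb 0 rfl⟩
  have hcont : Continuous (straighten e ψ) := by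
    unfold straighten; fun_prop
  have hmeas : MeasurableSet (straighten e ψ '' s) :=
    hs.image_of_continuousOn_injOn hcont.continuousOn hinj
  -- the measure preserving map back from the product
  have hmp1 := b.measurePreserving_repr_symm
  have hmp2 := PiLp.volume_preserving_toLp (Fin (m + 1))
  have hmp3 := (volume_preserving_piFinSuccAbove (fun _ : Fin (m + 1) => ℝ) 0).symm
  have hmp := (hmp1.comp hmp2).comp hmp3
  set T : ℝ × (Fin m → ℝ) → EuclideanSpace ℝ (Fin (m + 1)) := _ with hT
  change MeasurePreserving T _ _ at hmp
  have hTapp : ∀ p : ℝ × (Fin m → ℝ), T p = b.repr.symm (WithLp.toLp 2 (Fin.cons p.1 p.2)) := by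
    intro p
    simp only [hT, Function.comp]
    congr 2
    change (Fin.insertNthEquiv (fun _ => ℝ) 0) p = _
    rw [Fin.insertNthEquiv_zero]
    rfl
  have hTm : MeasurableSet (T ⁻¹' (straighten e ψ '' s)) := hmp.measurable hmeas
  refine ⟨fun t => volume (Prod.mk t ⁻¹' (T ⁻¹' (straighten e ψ '' s))),
    measurable_measure_prodMk_left hTm, ?_, ?_⟩
  · rw [← hmp.measure_preimage hmeas.nullMeasurableSet, ← Measure.prod_apply hTm]
    rfl
  · intro t
    let P : EuclideanSpace ℝ (Fin (m + 1)) → (Fin m → ℝ) := fun y j => inner ℝ (b j.succ) y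
    have hP : LipschitzWith 1 P := by
      refine LipschitzWith.of_dist_le_mul fun x y => ?_
      rw [NNReal.coe_one, one_mul, dist_pi_le_iff dist_nonneg]
      intro j
      simp only [P]
      rw [Real.dist_eq, ← inner_sub_right, dist_eq_norm]
      refine (abs_real_inner_le_norm _ _).trans ?_
      simp
    have hsub : Prod.mk t ⁻¹' (T ⁻¹' (straighten e ψ '' s)) ⊆ P '' (s ∩ ψ ⁻¹' {t}) := by
      rintro z ⟨y, hy, hyz⟩
      rw [hTapp, LinearIsometryEquiv.eq_symm_apply] at hyz
      have hcoord : ∀ i, inner ℝ (b i) (straighten e ψ y) = (Fin.cons t z : Fin (m + 1) → ℝ) i := by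
        intro i
        rw [← b.repr_apply_apply, hyz]
      refine ⟨y, ⟨hy, ?_⟩, ?_⟩
      · have := hcoord 0
        simp only [straighten, inner_add_right, inner_smul_right, hb, real_inner_self_eq_norm_sq,
          he, Fin.cons_zero] at this
        simp only [Set.mem_preimage, Set.mem_singleton_iff]
        linarith
      · funext j
        have := hcoord j.succ
        have h0 : inner ℝ (b j.succ) e = 0 := by
          rw [← hb]; exact b.orthonormal.2 (Fin.succ_ne_zero j)
        simp only [straighten, inner_add_right, inner_smul_right, h0, mul_zero, add_zero,
          Fin.cons_succ] at this
        exact this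
    refine (measure_mono hsub).trans ?_
    have hv : (volume : Measure (Fin m → ℝ)) = μH[(m : ℝ)] := by
      have := hausdorffMeasure_pi_real (ι := Fin m)
      rw [Fintype.card_fin] at this
      exact this.symm
    have := hP.hausdorffMeasure_image_le (d := (m : ℝ)) (by positivity) (s ∩ ψ ⁻¹' {t})
    rw [hv]
    simpa using this

lemma approx_lemma {m : ℕ} (A : EuclideanSpace ℝ (Fin (m + 1)) →L[ℝ] ℝ) (c : NNReal)
    (hc : (c : ℝ) < ‖A‖) :
    ∃ e : EuclideanSpace ℝ (Fin (m + 1)), ‖e‖ = 1 ∧ ∃ r : NNReal, r ≠ 0 ∧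
      ∀ (s : Set (EuclideanSpace ℝ (Fin (m + 1)))) (ψ : EuclideanSpace ℝ (Fin (m + 1)) → ℝ),
        ApproximatesLinearOn ψ A s r →
          Set.InjOn (straighten e ψ) s ∧ c * volume s ≤ volume (straighten e ψ '' s) := by
  have hA : 0 < ‖A‖ := c.2.trans_lt hc
  obtain ⟨e, he, hAe⟩ : ∃ e, ‖e‖ = 1 ∧ A e = ‖A‖ := by
    set v := (InnerProductSpace.toDual ℝ (EuclideanSpace ℝ (Fin (m + 1)))).symm A with hv
    have hvn : ‖v‖ = ‖A‖ := by simp [hv]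
    refine ⟨‖v‖⁻¹ • v, ?_, ?_⟩
    · rw [norm_smul, norm_inv, norm_norm, inv_mul_cancel₀]; rw [hvn]; exact hA.ne'
    · have : A v = ‖v‖ ^ 2 := by
        rw [← real_inner_self_eq_norm_sq]
        conv_rhs => rw [hv]
        rw [InnerProductSpace.toDual_symm_apply]
      rw [map_smul, this, ← hvn, smul_eq_mul]
      have : ‖v‖ ≠ 0 := by rw [hvn]; exact hA.ne'
      field_simp
  let B : EuclideanSpace ℝ (Fin (m + 1)) →L[ℝ] EuclideanSpace ℝ (Fin (m + 1)) :=
    ContinuousLinearMap.id ℝ _ + (A - innerSL ℝ e).smulRight e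
  have hdet : B.det = ‖A‖ := by
    have h1 : (B : EuclideanSpace ℝ (Fin (m + 1)) →ₗ[ℝ] EuclideanSpace ℝ (Fin (m + 1))) =
        LinearMap.transvection ((A - innerSL ℝ e : EuclideanSpace ℝ (Fin (m + 1)) →L[ℝ] ℝ) :
          EuclideanSpace ℝ (Fin (m + 1)) →ₗ[ℝ] ℝ) e := by
      ext x
      simp [B, LinearMap.transvection]
    rw [ContinuousLinearMap.det, h1, LinearMap.transvection.det]
    simp [hAe, he]
  have hev := mul_le_addHaar_image_of_lt_det (volume : Measure (EuclideanSpace ℝ (Fin (m + 1))))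
    B (m := c) (by
      rw [hdet, abs_of_pos hA, ENNReal.lt_ofReal_iff_toReal_lt ENNReal.coe_ne_top]
      simpa using hc)
  have hlt : ∀ᶠ δ in nhdsWithin (0 : NNReal) (Set.Ioi 0), δ < ‖A‖₊ :=
    nhdsWithin_le_nhds (Iio_mem_nhds (by exact_mod_cast hA))
  obtain ⟨r, ⟨hr1, hr2⟩, hr0⟩ := ((hev.and hlt).and self_mem_nhdsWithin).exists
  refine ⟨e, he, r, (ne_of_gt hr0), fun s ψ hs => ⟨?_, ?_⟩⟩
  · intro x hx y hy hxy
    simp only [straighten] at hxy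
    have hψ : ψ x = ψ y := by
      have := congrArg (inner ℝ e) hxy
      simpa [inner_add_right, inner_smul_right, he] using this
    have hd : x - y = (inner ℝ e x - inner ℝ e y) • e := by
      rw [hψ] at hxy
      rw [sub_smul]
      rw [sub_smul, sub_smul] at hxy
      have h2 : x + (ψ y • e - inner ℝ e x • e) - (y + (ψ y • e - inner ℝ e y • e)) = 0 :=
        sub_eq_zero.2 hxy
      rw [← sub_eq_zero, ← h2]
      abel
    have := hs x hx y hy
    rw [hψ, sub_self, zero_sub, norm_neg, hd, map_smul, hAe, norm_smul, norm_smul, he, norm_norm,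
      mul_one] at this
    have hr2' : (r : ℝ) < ‖A‖ := by exact_mod_cast hr2
    have h0 : ‖inner ℝ e x - inner ℝ e y‖ = 0 := by
      by_contra h
      have hpos : 0 < ‖inner ℝ e x - inner ℝ e y‖ := lt_of_le_of_ne (norm_nonneg _) (Ne.symm h)
      nlinarith
    rw [norm_eq_zero] at h0
    rw [h0, zero_smul] at hd
    exact sub_eq_zero.1 hd
  · apply hr1
    intro x hx y hy
    have h := hs x hx y hy
    have : straighten e ψ x - straighten e ψ y - B (x - y) = (ψ x - ψ y - A (x - y)) • e := by
      simp only [straighten, B, ContinuousLinearMap.add_apply, ContinuousLinearMap.id_apply,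
        ContinuousLinearMap.smulRight_apply, ContinuousLinearMap.sub_apply, innerSL_apply_apply,
        inner_sub_right]
      module
    rw [this, norm_smul, he, mul_one]
    exact h

lemma coarea_bound {m : ℕ} (ψ : EuclideanSpace ℝ (Fin (m + 1)) → ℝ) (hψ : Continuous ψ)
    (s : Set (EuclideanSpace ℝ (Fin (m + 1)))) (hs : MeasurableSet s)
    (hd : ∀ x ∈ s, DifferentiableAt ℝ ψ x) (c : NNReal) (hg : ∀ x ∈ s, (c : ℝ) < ‖fderiv ℝ ψ x‖)
    (I : Set ℝ) (hI : MeasurableSet I) (hsI : ∀ x ∈ s, ψ x ∈ I) (M : ENNReal)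
    (hM : ∀ t ∈ I, (μH[(m : ℝ)] : Measure (EuclideanSpace ℝ (Fin (m + 1)))) (s ∩ ψ ⁻¹' {t}) ≤ M) :
    c * volume s ≤ M * volume I := by
  rcases s.eq_empty_or_nonempty with rfl | hne
  · simp
  have hr : ∀ A : EuclideanSpace ℝ (Fin (m + 1)) →L[ℝ] ℝ, ∃ r : NNReal, r ≠ 0 ∧
      ((c : ℝ) < ‖A‖ → ∃ e : EuclideanSpace ℝ (Fin (m + 1)), ‖e‖ = 1 ∧
      ∀ (s : Set (EuclideanSpace ℝ (Fin (m + 1)))) (ψ : EuclideanSpace ℝ (Fin (m + 1)) → ℝ),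
        ApproximatesLinearOn ψ A s r →
          Set.InjOn (straighten e ψ) s ∧ c * volume s ≤ volume (straighten e ψ '' s)) := by
    intro A
    by_cases h : (c : ℝ) < ‖A‖
    · obtain ⟨e, he, r, hr, H⟩ := approx_lemma A c h
      exact ⟨r, hr, fun _ => ⟨e, he, H⟩⟩
    · exact ⟨1, one_ne_zero, fun h' => absurd h' h⟩
  choose r hr0 hr using hr
  obtain ⟨t, A, htd, htm, hst, happ, hA⟩ :=
    exists_partition_approximatesLinearOn_of_hasFDerivWithinAt ψ s (fderiv ℝ ψ)
      (fun x hx => (hd x hx).hasFDerivAt.hasFDerivWithinAt) r hr0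
  have key : ∀ n, ∃ g : ℝ → ENNReal, Measurable g ∧ c * volume (s ∩ t n) ≤ ∫⁻ u, g u ∧
      ∀ u, g u ≤ (μH[(m : ℝ)] : Measure (EuclideanSpace ℝ (Fin (m + 1))))
        ((s ∩ t n) ∩ ψ ⁻¹' {u}) := by
    intro n
    obtain ⟨y, hy, hyA⟩ := hA hne n
    obtain ⟨e, he, H⟩ := hr (A n) (by rw [hyA]; exact hg y hy)
    obtain ⟨hinj, hle⟩ := H _ _ (happ n)
    obtain ⟨g, hgm, hgi, hgl⟩ := slice_lemma e he ψ hψ _ (hs.inter (htm n)) hinj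
    exact ⟨g, hgm, hgi ▸ hle, hgl⟩
  choose g hgm hgi hgl using key
  calc c * volume s ≤ c * ∑' n, volume (s ∩ t n) := by
        gcongr
        refine (measure_mono ?_).trans (measure_iUnion_le _)
        rw [← Set.inter_iUnion]
        exact Set.subset_inter subset_rfl hst
    _ = ∑' n, c * volume (s ∩ t n) := ENNReal.tsum_mul_left.symm
    _ ≤ ∑' n, ∫⁻ u, g n u := ENNReal.tsum_le_tsum hgi
    _ = ∫⁻ u, ∑' n, g n u := (lintegral_tsum fun n => (hgm n).aemeasurable).symm
    _ ≤ ∫⁻ u, I.indicator (fun _ => M) u := by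
        refine lintegral_mono fun u => ?_
        have h1 : ∑' n, g n u ≤ (μH[(m : ℝ)] : Measure (EuclideanSpace ℝ (Fin (m + 1))))
            (s ∩ ψ ⁻¹' {u}) := by
          refine (ENNReal.tsum_le_tsum fun n => hgl n u).trans ?_
          rw [← measure_iUnion]
          · exact measure_mono (Set.iUnion_subset fun n x hx => ⟨hx.1.1, hx.2⟩)
          · intro i j hij
            exact (htd hij).mono (fun x hx => hx.1.2) (fun x hx => hx.1.2)
          · intro n
            exact (hs.inter (htm n)).inter (hψ.measurable (measurableSet_singleton u))
        refine h1.trans ?_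
        by_cases hu : u ∈ I
        · rw [Set.indicator_of_mem hu]; exact hM u hu
        · have : s ∩ ψ ⁻¹' {u} = ∅ := by
            ext x
            simp only [Set.mem_inter_iff, Set.mem_preimage, Set.mem_singleton_iff,
              Set.mem_empty_iff_false, iff_false, not_and]
            rintro hx rfl
            exact hu (hsI x hx)
          rw [this]; simp
    _ = M * volume I := by rw [lintegral_indicator hI, setLIntegral_const]

theorem stmt_11 (n : ℕ) (Ω : Set (EuclideanSpace ℝ (Fin n)))
    (hΩo : IsOpen Ω) (hΩb : Bornology.IsBounded Ω)
    (φ : EuclideanSpace ℝ (Fin n) → ℝ) (K : NNReal) (hφ : LipschitzOnWith K φ Ω)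
    (Cmin : ℝ) (hC : 0 < Cmin) (δ : ℝ) (hδ : 0 < δ)
    (hgrad : ∀ᵐ x ∂(volume : Measure (EuclideanSpace ℝ (Fin n))),
      x ∈ Ω ∩ φ ⁻¹' Set.Ioo (-δ) δ → Cmin ≤ ‖fderiv ℝ φ x‖)
    (M : ℝ) (hM : 0 ≤ M)
    (hH : ∀ ρ ∈ Set.Ioo (-δ) δ,
      (μH[(n:ℝ) - 1] : Measure (EuclideanSpace ℝ (Fin n))) (Ω ∩ φ ⁻¹' {ρ})
        ≤ ENNReal.ofReal M) :
    ∃ ε₀ > 0, ∀ ε ∈ Set.Ioo (0:ℝ) ε₀,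
      volume (Ω ∩ φ ⁻¹' Set.Ioc (-ε) 0) ≤ ENNReal.ofReal ((M / Cmin) * ε) := by
  refine ⟨δ, hδ, fun ε hε => ?_⟩
  rcases n with _ | m
  · have h0 : Ω ∩ φ ⁻¹' Set.Ioc (-ε) 0 ⊆
        {x | ¬ (x ∈ Ω ∩ φ ⁻¹' Set.Ioo (-δ) δ → Cmin ≤ ‖fderiv ℝ φ x‖)} := by
      rintro x ⟨hx, hx1, hx2⟩ h
      have h1 := h ⟨hx, by linarith [hε.2], by linarith⟩
      have h2 : fderiv ℝ φ x = 0 := by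
        ext v
        rw [Subsingleton.elim v 0]; simp
      rw [h2, norm_zero] at h1
      linarith
    have h3 : volume (Ω ∩ φ ⁻¹' Set.Ioc (-ε) 0) = 0 :=
      measure_mono_null h0 (ae_iff.1 hgrad)
    rw [h3]; exact zero_le
  · obtain ⟨ψ, hψ, heq⟩ := hφ.extend_real
    have hfd : ∀ x ∈ Ω, fderiv ℝ φ x = fderiv ℝ ψ x := fun x hx =>
      (heq.eventuallyEq_of_mem (hΩo.mem_nhds hx)).fderiv_eq
    set s : Set (EuclideanSpace ℝ (Fin (m + 1))) :=
      ((Ω ∩ ψ ⁻¹' Set.Ioc (-ε) 0) ∩ {x | DifferentiableAt ℝ ψ x}) ∩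
        {x | Cmin ≤ ‖fderiv ℝ ψ x‖} with hs_def
    have hs : MeasurableSet s :=
      ((hΩo.measurableSet.inter (hψ.continuous.measurable measurableSet_Ioc)).inter
        (measurableSet_of_differentiableAt ℝ ψ)).inter
        (measurableSet_le measurable_const (measurable_fderiv ℝ ψ).norm)
    have hle : volume (Ω ∩ φ ⁻¹' Set.Ioc (-ε) 0) ≤ volume s := by
      refine measure_mono_ae ?_
      filter_upwards [hgrad, hψ.ae_differentiableAt (μ := volume)] with x hx hxd hxm
      obtain ⟨hxΩ, hx1, hx2⟩ := hxm
      have hg := hx ⟨hxΩ, by linarith [hε.2], by linarith⟩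
      refine ⟨⟨⟨hxΩ, ?_⟩, hxd⟩, ?_⟩
      · rw [Set.mem_preimage]
        rw [← heq hxΩ]; exact ⟨hx1, hx2⟩
      · change Cmin ≤ _
        rw [← hfd x hxΩ]; exact hg
    have hmain : ENNReal.ofReal Cmin * volume s ≤ ENNReal.ofReal M * ENNReal.ofReal ε := by
      refine ENNReal.mul_le_of_forall_lt fun a ha b hb => ?_
      lift a to NNReal using ha.ne_top
      refine (mul_le_mul_right hb.le (a : ENNReal)).trans ?_
      have hac : (a : ℝ) < Cmin := by
        rw [ENNReal.lt_ofReal_iff_toReal_lt ENNReal.coe_ne_top] at ha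
        simpa using ha
      have := coarea_bound ψ hψ.continuous s hs (fun x hx => hx.1.2) a
        (fun x hx => hac.trans_le hx.2) (Set.Ioc (-ε) 0) measurableSet_Ioc
        (fun x hx => hx.1.1.2) (ENNReal.ofReal M) (fun t ht => by
          have h1 := hH t ⟨by linarith [ht.1, hε.2], by linarith [ht.2]⟩
          have h2 : ((m + 1 : ℕ) : ℝ) - 1 = m := by push_cast; ring
          rw [h2] at h1
          refine (measure_mono ?_).trans h1
          rintro x ⟨hx, hxt⟩
          refine ⟨hx.1.1.1, ?_⟩
          rw [Set.mem_preimage]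
          rw [heq hx.1.1.1]; exact hxt)
      simpa using this
    have hC' : ENNReal.ofReal Cmin ≠ 0 := by simpa using hC
    refine hle.trans ?_
    rw [div_mul_eq_mul_div, ENNReal.ofReal_div_of_pos hC, ENNReal.ofReal_mul hM,
      ENNReal.le_div_iff_mul_le (Or.inl hC') (Or.inl ENNReal.ofReal_ne_top), mul_comm]
    exact hmain
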